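/- (Implicit regularization for natural policy gradient.) Let K⁰ ∈ 𝒦 and let 0 < α ≤ 1 / max_{0≤t≤N−1} ‖G^{K⁰}_t‖, where ‖·‖ is the matrix operator norm. Define the natural policy gradient iterates inductively by K^{k+1}_t := K^k_t − 2α F^{K^k}_t for t ∈ {0,…,N−1} and k ≥ 0. Then every iterate is admissible, K^k ∈ 𝒦 for all k ≥ 0; the Riccati matrices are monotonically non-increasing: P^{K^{k+1}}_t ⪯ P^{K^k}_t for all t and k; and, if in addition Assumption 2.4 holds, then P^{K^k}_t ⪰ P*_t for all t and k. -/

import Mathlib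

open Matrix

noncomputable section

/-- Rayleigh-quotient value set of a square real matrix. -/
def rayleighSet {a : ℕ} (M : Matrix (Fin a) (Fin a) ℝ) : Set ℝ :=
  { r : ℝ | ∃ x : Fin a → ℝ, x ⬝ᵥ x = 1 ∧ r = x ⬝ᵥ M.mulVec x }

/-- Smallest eigenvalue (of a symmetric matrix), via the Rayleigh characterization. -/
def eigMin {a : ℕ} (M : Matrix (Fin a) (Fin a) ℝ) : ℝ := sInf (rayleighSet M)

/-- Largest eigenvalue (of a symmetric matrix), via the Rayleigh characterization. -/
def eigMax {a : ℕ} (M : Matrix (Fin a) (Fin a) ℝ) : ℝ := sSup (rayleighSet M)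

/-- Operator (spectral) norm of a real matrix. -/
def opNorm {a b : ℕ} (M : Matrix (Fin a) (Fin b) ℝ) : ℝ := Real.sqrt (eigMax (Mᵀ * M))

/-- Squared Frobenius norm. -/
def frobNormSq {a b : ℕ} (M : Matrix (Fin a) (Fin b) ℝ) : ℝ := ∑ i, ∑ j, (M i j) ^ 2

/-- Frobenius norm. -/
def frobNorm {a b : ℕ} (M : Matrix (Fin a) (Fin b) ℝ) : ℝ := Real.sqrt (frobNormSq M)

/-- Extend a finite tuple to a function on `ℕ` by zero. -/
def padZero {α : Type*} [Zero α] {N : ℕ} (f : Fin N → α) : ℕ → α :=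
  fun t => if h : t < N then f ⟨t, h⟩ else 0

/-- Data of a finite-horizon zero-sum LQ dynamic game with horizon `N`. -/
structure LQGame (m d n N : ℕ) where
  A : ℕ → Matrix (Fin m) (Fin m) ℝ
  B : ℕ → Matrix (Fin m) (Fin d) ℝ
  D : ℕ → Matrix (Fin m) (Fin n) ℝ
  Q : ℕ → Matrix (Fin m) (Fin m) ℝ
  QN : Matrix (Fin m) (Fin m) ℝ
  Ru : ℕ → Matrix (Fin d) (Fin d) ℝ
  Rw : ℕ → Matrix (Fin n) (Fin n) ℝ
  Sig : ℕ → Matrix (Fin m) (Fin m) ℝ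
  hQ : ∀ t < N, (Q t).PosSemidef
  hQN : QN.PosSemidef
  hRu : ∀ t < N, (Ru t).PosDef
  hRw : ∀ t < N, (Rw t).PosDef
  hSig : ∀ t ≤ N, (Sig t).PosDef

namespace LQGame

variable {m d n N : ℕ}

/-- Value matrices `P^{K,L}` indexed by the number `j` of steps before the terminal
time, i.e. `PKLaux g K L j = P^{K,L}_{N-j}`. -/
def PKLaux (g : LQGame m d n N) (K : ℕ → Matrix (Fin d) (Fin m) ℝ)
    (L : ℕ → Matrix (Fin n) (Fin m) ℝ) : ℕ → Matrix (Fin m) (Fin m) ℝ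
  | 0 => g.QN
  | j + 1 =>
      (g.A (N - (j+1)) - g.B (N - (j+1)) * K (N - (j+1)) - g.D (N - (j+1)) * L (N - (j+1)))ᵀ *
          PKLaux g K L j *
          (g.A (N - (j+1)) - g.B (N - (j+1)) * K (N - (j+1)) - g.D (N - (j+1)) * L (N - (j+1)))
        + g.Q (N - (j+1)) + (K (N - (j+1)))ᵀ * g.Ru (N - (j+1)) * K (N - (j+1))
        - (L (N - (j+1)))ᵀ * g.Rw (N - (j+1)) * L (N - (j+1))

/-- Value matrix `P^{K,L}_t`. -/
def PKL (g : LQGame m d n N) (K : ℕ → Matrix (Fin d) (Fin m) ℝ)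
    (L : ℕ → Matrix (Fin n) (Fin m) ℝ) (t : ℕ) : Matrix (Fin m) (Fin m) ℝ :=
  PKLaux g K L (N - t)

/-- Inner-loop Riccati matrices indexed by the number `j` of steps before the terminal
time, i.e. `PKaux g K j = P^K_{N-j}`. -/
def PKaux (g : LQGame m d n N) (K : ℕ → Matrix (Fin d) (Fin m) ℝ) :
    ℕ → Matrix (Fin m) (Fin m) ℝ
  | 0 => g.QN
  | j + 1 =>
      g.Q (N - (j+1)) + (K (N - (j+1)))ᵀ * g.Ru (N - (j+1)) * K (N - (j+1))
        + (g.A (N - (j+1)) - g.B (N - (j+1)) * K (N - (j+1)))ᵀ *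
          (PKaux g K j + PKaux g K j * g.D (N - (j+1)) *
            (g.Rw (N - (j+1)) - (g.D (N - (j+1)))ᵀ * PKaux g K j * g.D (N - (j+1)))⁻¹ *
            (g.D (N - (j+1)))ᵀ * PKaux g K j) *
          (g.A (N - (j+1)) - g.B (N - (j+1)) * K (N - (j+1)))

/-- Inner-loop Riccati matrix `P^K_t`. -/
def PK (g : LQGame m d n N) (K : ℕ → Matrix (Fin d) (Fin m) ℝ) (t : ℕ) :
    Matrix (Fin m) (Fin m) ℝ :=
  PKaux g K (N - t)

/-- `P̃^K_{t+1}`. -/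
def Ptilde (g : LQGame m d n N) (K : ℕ → Matrix (Fin d) (Fin m) ℝ) (t : ℕ) :
    Matrix (Fin m) (Fin m) ℝ :=
  g.PK K (t+1) + g.PK K (t+1) * g.D t *
    (g.Rw t - (g.D t)ᵀ * g.PK K (t+1) * g.D t)⁻¹ * (g.D t)ᵀ * g.PK K (t+1)

/-- `K ∈ 𝒦`. -/
def Admissible (g : LQGame m d n N) (K : ℕ → Matrix (Fin d) (Fin m) ℝ) : Prop :=
  ∀ t < N, (g.Rw t - (g.D t)ᵀ * g.PK K (t+1) * g.D t).PosDef

/-- The inner maximizer `L(K)`. -/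
def Lopt (g : LQGame m d n N) (K : ℕ → Matrix (Fin d) (Fin m) ℝ) (t : ℕ) :
    Matrix (Fin n) (Fin m) ℝ :=
  (-(g.Rw t) + (g.D t)ᵀ * g.PK K (t+1) * g.D t)⁻¹ *
    ((g.D t)ᵀ * g.PK K (t+1) * (g.A t - g.B t * K t))

/-- State covariances `X^{K,L}_t`. -/
def Xcov (g : LQGame m d n N) (K : ℕ → Matrix (Fin d) (Fin m) ℝ)
    (L : ℕ → Matrix (Fin n) (Fin m) ℝ) : ℕ → Matrix (Fin m) (Fin m) ℝ
  | 0 => g.Sig 0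
  | t + 1 =>
      (g.A t - g.B t * K t - g.D t * L t) * Xcov g K L t *
        (g.A t - g.B t * K t - g.D t * L t)ᵀ + g.Sig (t+1)

/-- The game value `G(K,L)`. -/
def value (g : LQGame m d n N) (K : ℕ → Matrix (Fin d) (Fin m) ℝ)
    (L : ℕ → Matrix (Fin n) (Fin m) ℝ) : ℝ :=
  ∑ t ∈ Finset.range (N+1), ((g.PKL K L t) * g.Sig t).trace

/-- `E^{K,L}_t`. -/
def Emat (g : LQGame m d n N) (K : ℕ → Matrix (Fin d) (Fin m) ℝ)
    (L : ℕ → Matrix (Fin n) (Fin m) ℝ) (t : ℕ) : Matrix (Fin n) (Fin m) ℝ :=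
  (-(g.Rw t) + (g.D t)ᵀ * g.PKL K L (t+1) * g.D t) * L t -
    (g.D t)ᵀ * g.PKL K L (t+1) * (g.A t - g.B t * K t)

/-- `H^{K,L}_t`. -/
def Hmat (g : LQGame m d n N) (K : ℕ → Matrix (Fin d) (Fin m) ℝ)
    (L : ℕ → Matrix (Fin n) (Fin m) ℝ) (t : ℕ) : Matrix (Fin n) (Fin n) ℝ :=
  g.Rw t - (g.D t)ᵀ * g.PKL K L (t+1) * g.D t

/-- `F^K_t`. -/
def Fmat (g : LQGame m d n N) (K : ℕ → Matrix (Fin d) (Fin m) ℝ) (t : ℕ) :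
    Matrix (Fin d) (Fin m) ℝ :=
  (g.Ru t + (g.B t)ᵀ * g.Ptilde K t * g.B t) * K t - (g.B t)ᵀ * g.Ptilde K t * g.A t

/-- `G^K_t`. -/
def Gmat (g : LQGame m d n N) (K : ℕ → Matrix (Fin d) (Fin m) ℝ) (t : ℕ) :
    Matrix (Fin d) (Fin d) ℝ :=
  g.Ru t + (g.B t)ᵀ * g.Ptilde K t * g.B t

/-- Game Riccati recursion `P*` indexed by steps before terminal time. -/
def Pstaraux (g : LQGame m d n N) : ℕ → Matrix (Fin m) (Fin m) ℝ
  | 0 => g.QN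
  | j + 1 =>
      g.Q (N - (j+1)) + (g.A (N - (j+1)))ᵀ * Pstaraux g j *
        (1 + (g.B (N - (j+1)) * (g.Ru (N - (j+1)))⁻¹ * (g.B (N - (j+1)))ᵀ
            - g.D (N - (j+1)) * (g.Rw (N - (j+1)))⁻¹ * (g.D (N - (j+1)))ᵀ) * Pstaraux g j)⁻¹ *
        g.A (N - (j+1))

/-- `P*_t`. -/
def Pstar (g : LQGame m d n N) (t : ℕ) : Matrix (Fin m) (Fin m) ℝ :=
  Pstaraux g (N - t)

/-- `Λ_t` of the game Riccati recursion. -/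
def LambdaStar (g : LQGame m d n N) (t : ℕ) : Matrix (Fin m) (Fin m) ℝ :=
  1 + (g.B t * (g.Ru t)⁻¹ * (g.B t)ᵀ - g.D t * (g.Rw t)⁻¹ * (g.D t)ᵀ) * g.Pstar (t+1)

/-- Assumption 2.4. -/
def Assumption24 (g : LQGame m d n N) : Prop :=
  (∀ t < N, IsUnit (g.LambdaStar t)) ∧ (∀ t ≤ N, (g.Pstar t).PosSemidef) ∧
    (∀ t < N, (g.Rw t - (g.D t)ᵀ * g.Pstar (t+1) * g.D t).PosDef)

/-- `φ := min_{0 ≤ t ≤ N} λ_min(Σ⁰_t)`. -/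
def phi (g : LQGame m d n N) : ℝ :=
  (Finset.range (N+1)).inf' (Finset.nonempty_range_iff.mpr (Nat.succ_ne_zero N))
    (fun t => eigMin (g.Sig t))

end LQGame

section QuadraticForms

variable {a b : ℕ}

theorem dotProduct_transpose_mulVec_eq (M : Matrix (Fin a) (Fin b) ℝ) (x : Fin b → ℝ)
    (y : Fin a → ℝ) : x ⬝ᵥ (Mᵀ *ᵥ y) = (M *ᵥ x) ⬝ᵥ y := by
  rw [dotProduct_mulVec, vecMul_transpose]

theorem Matrix.IsHermitian.dotProduct_mulVec_comm {M : Matrix (Fin a) (Fin a) ℝ}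
    (hM : M.IsHermitian) (x y : Fin a → ℝ) : x ⬝ᵥ (M *ᵥ y) = y ⬝ᵥ (M *ᵥ x) := by
  have hT : Mᵀ = M := by simpa [IsHermitian, conjTranspose_eq_transpose_of_trivial] using hM
  rw [← hT, dotProduct_transpose_mulVec_eq, dotProduct_comm, hT]

theorem Matrix.IsHermitian.transpose_mul_mul {M : Matrix (Fin a) (Fin a) ℝ}
    (hM : M.IsHermitian) (C : Matrix (Fin a) (Fin b) ℝ) : (Cᵀ * M * C).IsHermitian := by
  simpa [conjTranspose_eq_transpose_of_trivial] using isHermitian_conjTranspose_mul_mul C hM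

theorem posSemidef_sub_iff {M M' : Matrix (Fin a) (Fin a) ℝ} (hM : M.IsHermitian)
    (hM' : M'.IsHermitian) :
    (M - M').PosSemidef ↔ ∀ x, x ⬝ᵥ (M' *ᵥ x) ≤ x ⬝ᵥ (M *ᵥ x) := by
  rw [posSemidef_iff_dotProduct_mulVec, and_iff_right (hM.sub hM')]
  simp [sub_mulVec]

/-- Completion of the square for the robust value `P + P D (R - Dᵀ P D)⁻¹ Dᵀ P`. -/
theorem dotProduct_robust_sub (P : Matrix (Fin a) (Fin a) ℝ) (hP : P.IsHermitian)
    (D : Matrix (Fin a) (Fin b) ℝ) (R : Matrix (Fin b) (Fin b) ℝ)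
    (hH : (R - Dᵀ * P * D).PosDef) (x : Fin a → ℝ) (w : Fin b → ℝ) :
    x ⬝ᵥ ((P + P * D * (R - Dᵀ * P * D)⁻¹ * Dᵀ * P) *ᵥ x)
      - ((x + D *ᵥ w) ⬝ᵥ (P *ᵥ (x + D *ᵥ w)) - w ⬝ᵥ (R *ᵥ w))
      = (w - (R - Dᵀ * P * D)⁻¹ *ᵥ (Dᵀ *ᵥ (P *ᵥ x))) ⬝ᵥ ((R - Dᵀ * P * D) *ᵥ
          (w - (R - Dᵀ * P * D)⁻¹ *ᵥ (Dᵀ *ᵥ (P *ᵥ x)))) := by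
  set H := R - Dᵀ * P * D with hHdef
  set y := Dᵀ *ᵥ (P *ᵥ x) with hy
  set v := H⁻¹ *ᵥ y with hv
  have hHv : H *ᵥ v = y := by
    rw [hv, mulVec_mulVec, mul_nonsing_inv _ ((isUnit_iff_isUnit_det _).mp hH.isUnit), one_mulVec]
  have hR : R = H + Dᵀ * P * D := by rw [hHdef]; abel
  have hvw : v ⬝ᵥ (H *ᵥ w) = w ⬝ᵥ y := by rw [hH.1.dotProduct_mulVec_comm, hHv]
  have hxw : x ⬝ᵥ (P *ᵥ (D *ᵥ w)) = w ⬝ᵥ y := by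
    rw [hP.dotProduct_mulVec_comm, hy, dotProduct_transpose_mulVec_eq]
  have hxw' : (D *ᵥ w) ⬝ᵥ (P *ᵥ x) = w ⬝ᵥ y := by
    rw [hy, dotProduct_transpose_mulVec_eq]
  have hxx : x ⬝ᵥ ((P + P * D * H⁻¹ * Dᵀ * P) *ᵥ x) = x ⬝ᵥ (P *ᵥ x) + v ⬝ᵥ y := by
    have : (P * D * H⁻¹ * Dᵀ * P) *ᵥ x = P *ᵥ (D *ᵥ v) := by
      simp only [hv, hy, mulVec_mulVec, Matrix.mul_assoc]
    rw [add_mulVec, this, dotProduct_add, hP.dotProduct_mulVec_comm x (D *ᵥ v), hy,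
      dotProduct_transpose_mulVec_eq]
  rw [hxx, hR]
  simp only [mulVec_add, add_mulVec, mulVec_sub, dotProduct_add, add_dotProduct, sub_dotProduct,
    dotProduct_sub, ← mulVec_mulVec, dotProduct_transpose_mulVec_eq, hHv, hvw, hxw, hxw']
  ring

theorem le_dotProduct_robust (P : Matrix (Fin a) (Fin a) ℝ) (hP : P.IsHermitian)
    (D : Matrix (Fin a) (Fin b) ℝ) (R : Matrix (Fin b) (Fin b) ℝ)
    (hH : (R - Dᵀ * P * D).PosDef) (x : Fin a → ℝ) (w : Fin b → ℝ) :
    (x + D *ᵥ w) ⬝ᵥ (P *ᵥ (x + D *ᵥ w)) - w ⬝ᵥ (R *ᵥ w)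
      ≤ x ⬝ᵥ ((P + P * D * (R - Dᵀ * P * D)⁻¹ * Dᵀ * P) *ᵥ x) := by
  have h := dotProduct_robust_sub P hP D R hH x w
  have h' := hH.posSemidef.dotProduct_mulVec_nonneg
    (w - (R - Dᵀ * P * D)⁻¹ *ᵥ (Dᵀ *ᵥ (P *ᵥ x)))
  rw [star_trivial, ← h] at h'
  linarith

/-- The robust value is monotone in the Loewner order. -/
theorem dotProduct_robust_mono {P P' : Matrix (Fin a) (Fin a) ℝ} (hP : P.IsHermitian)
    (hP' : P'.IsHermitian) (hle : ∀ x, x ⬝ᵥ (P' *ᵥ x) ≤ x ⬝ᵥ (P *ᵥ x))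
    (D : Matrix (Fin a) (Fin b) ℝ) (R : Matrix (Fin b) (Fin b) ℝ)
    (hH : (R - Dᵀ * P * D).PosDef) (hH' : (R - Dᵀ * P' * D).PosDef) (x : Fin a → ℝ) :
    x ⬝ᵥ ((P' + P' * D * (R - Dᵀ * P' * D)⁻¹ * Dᵀ * P') *ᵥ x)
      ≤ x ⬝ᵥ ((P + P * D * (R - Dᵀ * P * D)⁻¹ * Dᵀ * P) *ᵥ x) := by
  set w := (R - Dᵀ * P' * D)⁻¹ *ᵥ (Dᵀ *ᵥ (P' *ᵥ x)) with hw
  have h' := dotProduct_robust_sub P' hP' D R hH' x w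
  rw [← hw, sub_self, zero_dotProduct] at h'
  have h := le_dotProduct_robust P hP D R hH x w
  linarith [hle (x + D *ᵥ w)]

theorem posDef_sub_transpose_mul_mul_mono {P P' : Matrix (Fin a) (Fin a) ℝ}
    (hP' : P'.IsHermitian) (hle : ∀ x, x ⬝ᵥ (P' *ᵥ x) ≤ x ⬝ᵥ (P *ᵥ x))
    (D : Matrix (Fin a) (Fin b) ℝ) {R : Matrix (Fin b) (Fin b) ℝ} (hR : R.IsHermitian)
    (hH : (R - Dᵀ * P * D).PosDef) : (R - Dᵀ * P' * D).PosDef := by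
  refine .of_dotProduct_mulVec_pos (hR.sub (hP'.transpose_mul_mul D)) fun {x} hx => ?_
  have h := hH.dotProduct_mulVec_pos hx
  have hD := hle (D *ᵥ x)
  simp only [star_trivial, sub_mulVec, dotProduct_sub, ← mulVec_mulVec,
    dotProduct_transpose_mulVec_eq] at h ⊢
  linarith

theorem isHermitian_robust {P : Matrix (Fin a) (Fin a) ℝ} (hP : P.IsHermitian)
    (D : Matrix (Fin a) (Fin b) ℝ) {R : Matrix (Fin b) (Fin b) ℝ} (hR : R.IsHermitian) :
    (P + P * D * (R - Dᵀ * P * D)⁻¹ * Dᵀ * P).IsHermitian := by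
  have hT : Pᵀ = P := by simpa [IsHermitian, conjTranspose_eq_transpose_of_trivial] using hP
  have h := (hR.sub (hP.transpose_mul_mul D)).inv.transpose_mul_mul (Dᵀ * P)
  rw [transpose_mul, transpose_transpose, hT, ← Matrix.mul_assoc] at h
  exact hP.add h

theorem bddAbove_rayleighSet (M : Matrix (Fin a) (Fin a) ℝ) : BddAbove (rayleighSet M) := by
  refine ⟨∑ i, ∑ j, |M i j|, ?_⟩
  rintro r ⟨x, hx, rfl⟩
  have hx1 : ∀ i, |x i| ≤ 1 := fun i => by
    rw [abs_le_one_iff_mul_self_le_one, ← hx]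
    exact Finset.single_le_sum (f := fun i => x i * x i) (fun i _ => mul_self_nonneg _)
      (Finset.mem_univ i)
  simp only [dotProduct, mulVec, Finset.mul_sum]
  refine Finset.sum_le_sum fun i _ => Finset.sum_le_sum fun j _ => ?_
  calc x i * (M i j * x j) ≤ |x i * (M i j * x j)| := le_abs_self _
    _ = |x i| * |x j| * |M i j| := by rw [abs_mul, abs_mul]; ring
    _ ≤ 1 * |M i j| := by
        gcongr
        exact mul_le_one₀ (hx1 i) (abs_nonneg _) (hx1 j)
    _ = |M i j| := one_mul _

theorem dotProduct_mulVec_le_eigMax (M : Matrix (Fin a) (Fin a) ℝ) (x : Fin a → ℝ) :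
    x ⬝ᵥ (M *ᵥ x) ≤ eigMax M * (x ⬝ᵥ x) := by
  rcases eq_or_ne x 0 with rfl | hx
  · simp
  have hpos : 0 < x ⬝ᵥ x := by simpa using dotProduct_star_self_pos_iff.mpr hx
  set s := √(x ⬝ᵥ x) with hs
  have hs0 : s ≠ 0 := (Real.sqrt_pos.mpr hpos).ne'
  have hss : s * s = x ⬝ᵥ x := Real.mul_self_sqrt hpos.le
  have hmem : (s⁻¹ • x) ⬝ᵥ (M *ᵥ (s⁻¹ • x)) ∈ rayleighSet M := by
    refine ⟨s⁻¹ • x, ?_, rfl⟩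
    simp only [smul_dotProduct, dotProduct_smul, smul_eq_mul, ← hss]
    field_simp
  have h := le_csSup (bddAbove_rayleighSet M) hmem
  simp only [mulVec_smul, smul_dotProduct, dotProduct_smul, smul_eq_mul] at h
  calc x ⬝ᵥ (M *ᵥ x) = (s⁻¹ * (s⁻¹ * x ⬝ᵥ (M *ᵥ x))) * (s * s) := by field_simp
    _ ≤ eigMax M * (s * s) := by
        gcongr
        exact h
    _ = _ := by rw [hss]

theorem dotProduct_mulVec_le_opNorm (M : Matrix (Fin a) (Fin a) ℝ) (x : Fin a → ℝ) :
    x ⬝ᵥ (M *ᵥ x) ≤ opNorm M * (x ⬝ᵥ x) := by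
  have hxx : 0 ≤ x ⬝ᵥ x := by simpa using dotProduct_star_self_nonneg x
  have hMM : (M *ᵥ x) ⬝ᵥ (M *ᵥ x) ≤ eigMax (Mᵀ * M) * (x ⬝ᵥ x) := by
    simpa only [← mulVec_mulVec, dotProduct_transpose_mulVec_eq] using
      dotProduct_mulVec_le_eigMax (Mᵀ * M) x
  have hcs : (x ⬝ᵥ (M *ᵥ x)) ^ 2 ≤ (x ⬝ᵥ x) * ((M *ᵥ x) ⬝ᵥ (M *ᵥ x)) := by
    simpa only [dotProduct, ← sq] using Finset.sum_mul_sq_le_sq_mul_sq Finset.univ x (M *ᵥ x)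
  calc x ⬝ᵥ (M *ᵥ x) ≤ √(eigMax (Mᵀ * M) * (x ⬝ᵥ x) ^ 2) := by
        refine Real.le_sqrt_of_sq_le (hcs.trans ?_)
        calc _ ≤ (x ⬝ᵥ x) * (eigMax (Mᵀ * M) * (x ⬝ᵥ x)) := by gcongr
          _ = _ := by ring
    _ = opNorm M * (x ⬝ᵥ x) := by
        rw [Real.sqrt_mul' _ (sq_nonneg _), Real.sqrt_sq hxx, opNorm]

end QuadraticForms

namespace LQGame

variable {m d n N : ℕ} (g : LQGame m d n N) (K K' : ℕ → Matrix (Fin d) (Fin m) ℝ)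

theorem PK_terminal : g.PK K N = g.QN := by simp [PK, PKaux]

theorem Pstar_terminal : g.Pstar N = g.QN := by simp [Pstar, Pstaraux]

theorem PK_of_lt {t : ℕ} (ht : t < N) :
    g.PK K t = g.Q t + (K t)ᵀ * g.Ru t * K t
      + (g.A t - g.B t * K t)ᵀ * g.Ptilde K t * (g.A t - g.B t * K t) := by
  obtain ⟨j, hj⟩ : ∃ j, N - t = j + 1 := ⟨N - t - 1, by lia⟩
  have hj' : N - (t + 1) = j := by lia
  have ht' : N - (j + 1) = t := by lia
  simp only [PK, Ptilde, hj, hj', PKaux, ht']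

theorem Pstar_of_lt {t : ℕ} (ht : t < N) :
    g.Pstar t = g.Q t + (g.A t)ᵀ * g.Pstar (t + 1) * (g.LambdaStar t)⁻¹ * g.A t := by
  obtain ⟨j, hj⟩ : ∃ j, N - t = j + 1 := ⟨N - t - 1, by lia⟩
  have hj' : N - (t + 1) = j := by lia
  have ht' : N - (j + 1) = t := by lia
  simp only [Pstar, LambdaStar, hj, hj', Pstaraux, ht']

/-- Backward induction over the stages of the game. -/
theorem backward_induction {p : ℕ → Prop} (hN : p N) (hs : ∀ t < N, p (t + 1) → p t) :
    ∀ t ≤ N, p t :=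
  fun _ ht => Nat.decreasingInduction' (fun k hk _ => hs k hk) ht hN

theorem isHermitian_PK : ∀ t ≤ N, (g.PK K t).IsHermitian := by
  refine backward_induction (by rw [PK_terminal]; exact g.hQN.1) fun t ht ih => ?_
  rw [g.PK_of_lt K ht]
  exact ((g.hQ t ht).1.add ((g.hRu t ht).1.transpose_mul_mul _)).add
    ((isHermitian_robust ih _ (g.hRw t ht).1).transpose_mul_mul _)

theorem isHermitian_Ptilde {t : ℕ} (ht : t < N) : (g.Ptilde K t).IsHermitian :=
  isHermitian_robust (g.isHermitian_PK K (t + 1) ht) _ (g.hRw t ht).1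

theorem dotProduct_PK {t : ℕ} (ht : t < N) (x : Fin m → ℝ) :
    x ⬝ᵥ (g.PK K t *ᵥ x) = x ⬝ᵥ (g.Q t *ᵥ x) + (K t *ᵥ x) ⬝ᵥ (g.Ru t *ᵥ (K t *ᵥ x))
      + (g.A t *ᵥ x - g.B t *ᵥ (K t *ᵥ x)) ⬝ᵥ
        (g.Ptilde K t *ᵥ (g.A t *ᵥ x - g.B t *ᵥ (K t *ᵥ x))) := by
  simp only [g.PK_of_lt K ht, add_mulVec, dotProduct_add, ← mulVec_mulVec,
    dotProduct_transpose_mulVec_eq, sub_mulVec]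

variable {g K K'}

theorem dotProduct_Ptilde_mono (hK : g.Admissible K) {t : ℕ} (ht : t < N)
    (hle : ∀ x, x ⬝ᵥ (g.PK K' (t + 1) *ᵥ x) ≤ x ⬝ᵥ (g.PK K (t + 1) *ᵥ x)) (x : Fin m → ℝ) :
    x ⬝ᵥ (g.Ptilde K' t *ᵥ x) ≤ x ⬝ᵥ (g.Ptilde K t *ᵥ x) :=
  have hP' := g.isHermitian_PK K' (t + 1) ht
  dotProduct_robust_mono (g.isHermitian_PK K (t + 1) ht) hP' hle _ _ (hK t ht)
    (posDef_sub_transpose_mul_mul_mono hP' hle _ (g.hRw t ht).1 (hK t ht)) x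

theorem Admissible.of_le (hK : g.Admissible K)
    (hle : ∀ t ≤ N, ∀ x, x ⬝ᵥ (g.PK K' t *ᵥ x) ≤ x ⬝ᵥ (g.PK K t *ᵥ x)) : g.Admissible K' :=
  fun t ht => posDef_sub_transpose_mul_mul_mono (g.isHermitian_PK K' (t + 1) ht)
    (hle (t + 1) ht) _ (g.hRw t ht).1 (hK t ht)

theorem dotProduct_Gmat_mono (hK : g.Admissible K)
    (hle : ∀ t ≤ N, ∀ x, x ⬝ᵥ (g.PK K' t *ᵥ x) ≤ x ⬝ᵥ (g.PK K t *ᵥ x)) {t : ℕ} (ht : t < N)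
    (v : Fin d → ℝ) : v ⬝ᵥ (g.Gmat K' t *ᵥ v) ≤ v ⬝ᵥ (g.Gmat K t *ᵥ v) := by
  simp only [Gmat, add_mulVec, dotProduct_add, ← mulVec_mulVec, dotProduct_transpose_mulVec_eq]
  linarith [dotProduct_Ptilde_mono hK ht (hle (t + 1) ht) (g.B t *ᵥ v)]

/-- A natural policy gradient step with `α G ⪯ I` decreases the Riccati matrices. -/
theorem dotProduct_PK_npg_step_le {α : ℝ} (hα : 0 ≤ α) (hK : g.Admissible K)
    (hG : ∀ t < N, ∀ v, α * (v ⬝ᵥ (g.Gmat K t *ᵥ v)) ≤ v ⬝ᵥ v)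
    (hstep : ∀ t < N, K' t = K t - (2 * α) • g.Fmat K t) :
    ∀ t ≤ N, ∀ x, x ⬝ᵥ (g.PK K' t *ᵥ x) ≤ x ⬝ᵥ (g.PK K t *ᵥ x) := by
  refine backward_induction (by simp [PK_terminal]) fun t ht ih x => ?_
  set u := K t *ᵥ x with hu
  set f := g.Fmat K t *ᵥ x with hf
  set y := g.A t *ᵥ x - g.B t *ᵥ u with hy
  have hu' : K' t *ᵥ x = u - (2 * α) • f := by
    rw [hstep t ht, sub_mulVec, smul_mulVec]
  have hy' : g.A t *ᵥ x - g.B t *ᵥ (u - (2 * α) • f) = y + (2 * α) • (g.B t *ᵥ f) := by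
    rw [mulVec_sub, mulVec_smul, hy]; abel
  have hff : f ⬝ᵥ f = f ⬝ᵥ (g.Ru t *ᵥ u) - (g.B t *ᵥ f) ⬝ᵥ (g.Ptilde K t *ᵥ y) := by
    have : f = g.Ru t *ᵥ u - (g.B t)ᵀ *ᵥ (g.Ptilde K t *ᵥ y) := by
      simp only [hf, Fmat, hy, hu, sub_mulVec, add_mulVec, mulVec_sub, ← mulVec_mulVec]
      abel
    calc f ⬝ᵥ f = f ⬝ᵥ (g.Ru t *ᵥ u - (g.B t)ᵀ *ᵥ (g.Ptilde K t *ᵥ y)) := by rw [← this]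
      _ = _ := by rw [dotProduct_sub, dotProduct_transpose_mulVec_eq]
  have hGf := hG t ht f
  simp only [Gmat, add_mulVec, dotProduct_add, ← mulVec_mulVec,
    dotProduct_transpose_mulVec_eq] at hGf
  have hmono := dotProduct_Ptilde_mono hK ht ih (y + (2 * α) • (g.B t *ᵥ f))
  rw [g.dotProduct_PK K' ht, g.dotProduct_PK K ht, ← hu, hu', hy', ← hy]
  have hR := (g.hRu t ht).1.dotProduct_mulVec_comm u f
  have hP := (g.isHermitian_Ptilde K ht).dotProduct_mulVec_comm y (g.B t *ᵥ f)
  simp only [mulVec_add, mulVec_sub, mulVec_smul, dotProduct_add, add_dotProduct, sub_dotProduct,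
    dotProduct_sub, smul_dotProduct, dotProduct_smul, smul_eq_mul, hR, hP] at hmono ⊢
  nlinarith [mul_le_mul_of_nonneg_left hGf hα]

/-- The game Riccati matrices bound the inner-loop Riccati matrices from below. -/
theorem dotProduct_Pstar_le (h : g.Assumption24) (hK : g.Admissible K) :
    ∀ t ≤ N, ∀ x, x ⬝ᵥ (g.Pstar t *ᵥ x) ≤ x ⬝ᵥ (g.PK K t *ᵥ x) := by
  refine backward_induction (by simp [PK_terminal, Pstar_terminal]) fun t ht ih x => ?_
  have hPpsd := h.2.1 (t + 1) ht
  set P := g.Pstar (t + 1) with hPdef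
  set y := g.A t *ᵥ x with hy
  set z := (g.LambdaStar t)⁻¹ *ᵥ y with hz
  set u := (g.Ru t)⁻¹ *ᵥ ((g.B t)ᵀ *ᵥ (P *ᵥ z)) with hu
  set w := (g.Rw t)⁻¹ *ᵥ ((g.D t)ᵀ *ᵥ (P *ᵥ z)) with hw
  obtain ⟨v, hKx⟩ : ∃ v, K t *ᵥ x = u + v := ⟨K t *ᵥ x - u, by abel⟩
  have hRu : g.Ru t *ᵥ u = (g.B t)ᵀ *ᵥ (P *ᵥ z) := by
    rw [hu, mulVec_mulVec, mul_nonsing_inv _ ((isUnit_iff_isUnit_det _).mp (g.hRu t ht).isUnit),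
      one_mulVec]
  have hRw : g.Rw t *ᵥ w = (g.D t)ᵀ *ᵥ (P *ᵥ z) := by
    rw [hw, mulVec_mulVec, mul_nonsing_inv _ ((isUnit_iff_isUnit_det _).mp (g.hRw t ht).isUnit),
      one_mulVec]
  have hyz : y = z + g.B t *ᵥ u - g.D t *ᵥ w := by
    have hΛ : g.LambdaStar t *ᵥ z = y := by
      rw [hz, mulVec_mulVec, mul_nonsing_inv _ ((isUnit_iff_isUnit_det _).mp (h.1 t ht)),
        one_mulVec]
    rw [← hΛ, LambdaStar, ← hPdef]
    simp only [add_mulVec, sub_mulVec, one_mulVec, ← mulVec_mulVec, hu, hw]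
    abel
  have hstate : y - g.B t *ᵥ (u + v) + g.D t *ᵥ w = z - g.B t *ᵥ v := by
    rw [hyz, mulVec_add]; abel
  have hrob := le_dotProduct_robust _ (g.isHermitian_PK K (t + 1) ht) (g.D t) (g.Rw t) (hK t ht)
    (y - g.B t *ᵥ (u + v)) w
  have hPK := ih (y - g.B t *ᵥ (u + v) + g.D t *ᵥ w)
  have hstar : x ⬝ᵥ (g.Pstar t *ᵥ x) = x ⬝ᵥ (g.Q t *ᵥ x) + y ⬝ᵥ (P *ᵥ z) := by
    simp only [g.Pstar_of_lt ht, add_mulVec, dotProduct_add, ← mulVec_mulVec,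
      dotProduct_transpose_mulVec_eq, hy, hz, hPdef]
  have hvR := (g.hRu t ht).posSemidef.dotProduct_mulVec_nonneg v
  have hvP := hPpsd.dotProduct_mulVec_nonneg (g.B t *ᵥ v)
  have hcomm := hPpsd.1.dotProduct_mulVec_comm z (g.B t *ᵥ v)
  have hcomm' := (g.hRu t ht).1.dotProduct_mulVec_comm u v
  rw [star_trivial] at hvR hvP
  have hyPz : y ⬝ᵥ (P *ᵥ z) = z ⬝ᵥ (P *ᵥ z) + (g.B t *ᵥ u) ⬝ᵥ (P *ᵥ z)
      - (g.D t *ᵥ w) ⬝ᵥ (P *ᵥ z) := by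
    conv_lhs => rw [hyz]
    rw [sub_dotProduct, add_dotProduct]
  rw [hstar, g.dotProduct_PK K ht, hKx, hyPz, ← hy]
  rw [← Ptilde] at hrob
  rw [hstate] at hPK hrob
  have hR : (u + v) ⬝ᵥ (g.Ru t *ᵥ (u + v)) = (g.B t *ᵥ u) ⬝ᵥ (P *ᵥ z)
      + 2 * ((g.B t *ᵥ v) ⬝ᵥ (P *ᵥ z)) + v ⬝ᵥ (g.Ru t *ᵥ v) := by
    rw [mulVec_add, dotProduct_add, add_dotProduct, add_dotProduct, hcomm', hRu,
      dotProduct_transpose_mulVec_eq, dotProduct_transpose_mulVec_eq]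
    ring
  have hW : w ⬝ᵥ (g.Rw t *ᵥ w) = (g.D t *ᵥ w) ⬝ᵥ (P *ᵥ z) := by
    rw [hRw, dotProduct_transpose_mulVec_eq]
  have hZ : (z - g.B t *ᵥ v) ⬝ᵥ (P *ᵥ (z - g.B t *ᵥ v)) = z ⬝ᵥ (P *ᵥ z)
      - 2 * ((g.B t *ᵥ v) ⬝ᵥ (P *ᵥ z)) + (g.B t *ᵥ v) ⬝ᵥ (P *ᵥ (g.B t *ᵥ v)) := by
    rw [mulVec_sub, dotProduct_sub, sub_dotProduct, sub_dotProduct, hcomm]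
    ring
  linarith

end LQGame

/-- implicit regularization for the natural policy gradient outer-loop updates. -/
theorem LQGame.npg_implicit_regularization {m d n N : ℕ} (g : LQGame m d n N)
    (hN : 0 < N) (K0 : ℕ → Matrix (Fin d) (Fin m) ℝ) (hK0 : g.Admissible K0)
    (α : ℝ) (hα0 : 0 < α)
    (hα : α ≤ 1 / (Finset.range N).sup' (Finset.nonempty_range_iff.mpr hN.ne')
      (fun t => opNorm (g.Gmat K0 t)))
    (Kseq : ℕ → ℕ → Matrix (Fin d) (Fin m) ℝ) (hinit : Kseq 0 = K0)
    (hstep : ∀ k : ℕ, ∀ t < N, Kseq (k+1) t = Kseq k t - (2 * α) • g.Fmat (Kseq k) t) :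
    (∀ k : ℕ, g.Admissible (Kseq k))
    ∧ (∀ k : ℕ, ∀ t ≤ N, (g.PK (Kseq k) t - g.PK (Kseq (k+1)) t).PosSemidef)
    ∧ (g.Assumption24 → ∀ k : ℕ, ∀ t ≤ N, (g.PK (Kseq k) t - g.Pstar t).PosSemidef) := by
  have hG0 : ∀ t < N, ∀ v, α * (v ⬝ᵥ (g.Gmat K0 t *ᵥ v)) ≤ v ⬝ᵥ v := by
    intro t ht v
    set S := (Finset.range N).sup' (Finset.nonempty_range_iff.mpr hN.ne')
      (fun t => opNorm (g.Gmat K0 t))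
    have hS : 0 < S := one_div_pos.mp (hα0.trans_le hα)
    have hle : opNorm (g.Gmat K0 t) ≤ S :=
      Finset.le_sup' (fun t => opNorm (g.Gmat K0 t)) (Finset.mem_range.mpr ht)
    have hvv : 0 ≤ v ⬝ᵥ v := by simpa using dotProduct_star_self_nonneg v
    calc α * (v ⬝ᵥ (g.Gmat K0 t *ᵥ v)) ≤ α * (S * (v ⬝ᵥ v)) := by
          gcongr
          exact (dotProduct_mulVec_le_opNorm _ v).trans (by gcongr)
      _ = (α * S) * (v ⬝ᵥ v) := by ring
      _ ≤ 1 * (v ⬝ᵥ v) := by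
          gcongr
          exact (le_div_iff₀ hS).mp hα
      _ = v ⬝ᵥ v := one_mul _
  have main : ∀ k, g.Admissible (Kseq k) ∧
      ∀ t < N, ∀ v, α * (v ⬝ᵥ (g.Gmat (Kseq k) t *ᵥ v)) ≤ v ⬝ᵥ v := by
    intro k
    induction k with
    | zero => exact hinit ▸ ⟨hK0, hG0⟩
    | succ k ih =>
      have hle := dotProduct_PK_npg_step_le hα0.le ih.1 ih.2 (hstep k)
      refine ⟨ih.1.of_le hle, fun t ht v => le_trans ?_ (ih.2 t ht v)⟩
      gcongr
      exact dotProduct_Gmat_mono ih.1 hle ht v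
  refine ⟨fun k => (main k).1, fun k t ht => ?_, fun h k t ht => ?_⟩
  · exact (posSemidef_sub_iff (g.isHermitian_PK _ t ht) (g.isHermitian_PK _ t ht)).mpr
      (dotProduct_PK_npg_step_le hα0.le (main k).1 (main k).2 (hstep k) t ht)
  · exact (posSemidef_sub_iff (g.isHermitian_PK _ t ht) (h.2.1 t ht).1).mpr
      (dotProduct_Pstar_le h (main k).1 t ht)
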